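/- arXiv:1402.0334 — 2 statements merged into one kernel-verified Lean document; each statement's English description precedes it below -/
import Mathlib

section
/- The intersection over all λ ∈ h* of the annihilators Ann_U(Δ(λ)) of the Verma modules Δ(λ) in U is zero. -/
namespace Schrodinger

noncomputable section

open scoped TensorProduct

/-- Generators of the Schrödinger algebra. -/
inductive Gen : Type
  | E | H | F | P | Q | Z
  deriving DecidableEq

/-- The free algebra on the generators. -/
abbrev FA : Type := FreeAlgebra ℂ Gen

/-- Inclusion of generators. -/
def ιg (g : Gen) : FA := FreeAlgebra.ι ℂ g

/-- The defining relations of the universal enveloping algebra of the Schrödinger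
algebra `s`: `z` is central and `[h,e]=2e`, `[e,f]=h`, `[h,f]=-2f`, `[e,q]=p`,
`[e,p]=0`, `[h,p]=p`, `[f,p]=q`, `[f,q]=0`, `[h,q]=-q`, `[p,q]=z`. -/
inductive Rel : FA → FA → Prop
  | he : Rel (ιg .H * ιg .E) (ιg .E * ιg .H + 2 * ιg .E)
  | ef : Rel (ιg .E * ιg .F) (ιg .F * ιg .E + ιg .H)
  | hf : Rel (ιg .H * ιg .F) (ιg .F * ιg .H - 2 * ιg .F)
  | eq : Rel (ιg .E * ιg .Q) (ιg .Q * ιg .E + ιg .P)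
  | ep : Rel (ιg .E * ιg .P) (ιg .P * ιg .E)
  | hp : Rel (ιg .H * ιg .P) (ιg .P * ιg .H + ιg .P)
  | fp : Rel (ιg .F * ιg .P) (ιg .P * ιg .F + ιg .Q)
  | fq : Rel (ιg .F * ιg .Q) (ιg .Q * ιg .F)
  | hq : Rel (ιg .H * ιg .Q) (ιg .Q * ιg .H - ιg .Q)
  | pq : Rel (ιg .P * ιg .Q) (ιg .Q * ιg .P + ιg .Z)
  | ze : Rel (ιg .Z * ιg .E) (ιg .E * ιg .Z)
  | zh : Rel (ιg .Z * ιg .H) (ιg .H * ιg .Z)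
  | zf : Rel (ιg .Z * ιg .F) (ιg .F * ιg .Z)
  | zp : Rel (ιg .Z * ιg .P) (ιg .P * ιg .Z)
  | zq : Rel (ιg .Z * ιg .Q) (ιg .Q * ιg .Z)

/-- The universal enveloping algebra `U = U(s)` of the Schrödinger algebra,
presented by generators and relations (via the PBW theorem). -/
abbrev U : Type := RingQuot Rel

/-- The generators of `U`. -/
def gen (g : Gen) : U := RingQuot.mkAlgHom ℂ Rel (ιg g)

def E : U := gen .E
def H : U := gen .H
def F : U := gen .F
def P : U := gen .P
def Q : U := gen .Q
def Z : U := gen .Z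

/-- Scalars inside `U`. -/
def sc (a : ℂ) : U := algebraMap ℂ U a

/-- The Casimir element `c = (h² + h + 4fe)z − 2(fp² − eq² − hpq)`. -/
def cElt : U := (H * H + H + 4 * (F * E)) * Z - 2 * (F * (P * P) - E * (Q * Q) - H * (P * Q))

/-- The left ideal of `U` defining the Verma module `Δ(λ)` for
`λ ∈ 𝔥*` with `λ(h) = hh`, `λ(z) = zz`:  it is generated by `n₊ = span{e,p}`
together with `h - λ(h)` and `z - λ(z)`; then
`Δ(λ) = U ⊗_{U(𝔟)} ℂ_λ ≅ U / U(e, p, h - λ(h), z - λ(z))`. -/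
def vermaIdeal (hh zz : ℂ) : Submodule U U :=
  Submodule.span U ({E, P, H - sc hh, Z - sc zz} : Set U)

/-- The Verma module `Δ(λ)` with highest weight `λ`, `λ(h) = hh`, `λ(z) = zz`. -/
abbrev Verma (hh zz : ℂ) : Type := U ⧸ vermaIdeal hh zz

/-- The canonical highest weight generator `v_λ` of `Δ(λ)`. -/
def hwVec (hh zz : ℂ) : Verma hh zz := Submodule.Quotient.mk 1

/-- The unique maximal submodule `K(λ)` of `Δ(λ)`. -/
def vermaRad (hh zz : ℂ) : Submodule U (Verma hh zz) := sSup {N : Submodule U (Verma hh zz) | N ≠ ⊤}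

/-- The simple highest weight module `L(λ) = Δ(λ)/K(λ)`. -/
abbrev SimpleHW (hh zz : ℂ) : Type := Verma hh zz ⧸ vermaRad hh zz

/-- The scalar `ϑ_λ = (λ(h)² + 3λ(h) + 2)·λ(z)` by which the Casimir element `c`
acts on the Verma module `Δ(λ)`. -/
def vartheta (hh zz : ℂ) : ℂ := (hh ^ 2 + 3 * hh + 2) * zz

end

end Schrodinger

namespace Schrodinger

/-! ### Ordered monomials span `U` -/

theorem adjoin_range_gen : Algebra.adjoin ℂ (Set.range gen) = ⊤ := by
  have h : Set.range gen = RingQuot.mkAlgHom ℂ Rel '' Set.range (FreeAlgebra.ι ℂ) := by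
    rw [← Set.range_comp]; rfl
  rw [h, ← AlgHom.map_adjoin, FreeAlgebra.adjoin_range_ι, Algebra.map_top,
    AlgHom.range_eq_top]
  exact RingQuot.mkAlgHom_surjective ℂ Rel

/-- The product of a word in the generators. -/
noncomputable def word (l : List Gen) : U := (l.map gen).prod

/-- The span of the words of length at most `n`. -/
noncomputable def wordSpan (n : ℕ) : Submodule ℂ U :=
  Submodule.span ℂ (word '' {l | l.length ≤ n})

theorem word_mem_wordSpan {l : List Gen} {n : ℕ} (h : l.length ≤ n) : word l ∈ wordSpan n :=
  Submodule.subset_span ⟨l, h, rfl⟩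

theorem wordSpan_mono {m n : ℕ} (h : m ≤ n) : wordSpan m ≤ wordSpan n :=
  Submodule.span_mono (Set.image_mono fun _ hl => le_trans hl h)

theorem gen_mul_mem_wordSpan (g : Gen) {n : ℕ} {u : U} (hu : u ∈ wordSpan n) :
    gen g * u ∈ wordSpan (n + 1) := by
  induction hu using Submodule.span_induction with
  | mem x hx =>
    obtain ⟨l, hl, rfl⟩ := hx
    have : gen g * word l = word (g :: l) := by simp [word]
    rw [this]
    exact word_mem_wordSpan (by simpa using hl)
  | zero => simp
  | add x y _ _ hx hy => rw [mul_add]; exact add_mem hx hy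
  | smul a x _ hx => rw [mul_smul_comm]; exact Submodule.smul_mem _ _ hx

theorem mkAlgHom_rel {a b : FA} (h : Rel a b) :
    RingQuot.mkAlgHom ℂ Rel a = RingQuot.mkAlgHom ℂ Rel b :=
  RingQuot.mkAlgHom_rel ℂ h

theorem commutator_mem_span_gen (g g' : Gen) :
    gen g * gen g' - gen g' * gen g ∈ Submodule.span ℂ (Set.range gen) := by
  have hg (x : Gen) : gen x ∈ Submodule.span ℂ (Set.range gen) := Submodule.subset_span ⟨x, rfl⟩
  have h2 (x : Gen) : 2 * gen x ∈ Submodule.span ℂ (Set.range gen) := by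
    rw [two_mul]; exact add_mem (hg x) (hg x)
  have he := mkAlgHom_rel Rel.he
  have ef := mkAlgHom_rel Rel.ef
  have hf := mkAlgHom_rel Rel.hf
  have eq := mkAlgHom_rel Rel.eq
  have ep := mkAlgHom_rel Rel.ep
  have hp := mkAlgHom_rel Rel.hp
  have fp := mkAlgHom_rel Rel.fp
  have fq := mkAlgHom_rel Rel.fq
  have hq := mkAlgHom_rel Rel.hq
  have pq := mkAlgHom_rel Rel.pq
  have ze := mkAlgHom_rel Rel.ze
  have zh := mkAlgHom_rel Rel.zh
  have zf := mkAlgHom_rel Rel.zf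
  have zp := mkAlgHom_rel Rel.zp
  have zq := mkAlgHom_rel Rel.zq
  simp only [map_mul, map_add, map_sub, map_ofNat] at he ef hf eq ep hp fp fq hq pq ze zh zf zp zq
  simp only [← gen.eq_1] at he ef hf eq ep hp fp fq hq pq ze zh zf zp zq
  cases g <;> cases g' <;>
    simp [he, ef, hf, eq, ep, hp, fp, fq, hq, pq, ze, zh, zf, zp, zq, hg, h2, sub_add_cancel_left]

theorem commutator_mul_mem_wordSpan (g g' : Gen) {n : ℕ} {u : U} (hu : u ∈ wordSpan n) :
    (gen g * gen g' - gen g' * gen g) * u ∈ wordSpan (n + 1) := by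
  have hc := commutator_mem_span_gen g g'
  generalize gen g * gen g' - gen g' * gen g = c at hc ⊢
  induction hc using Submodule.span_induction with
  | mem x hx => obtain ⟨k, rfl⟩ := hx; exact gen_mul_mem_wordSpan k hu
  | zero => simp
  | add x y _ _ hx hy => rw [add_mul]; exact add_mem hx hy
  | smul a x _ hx => rw [smul_mul_assoc]; exact Submodule.smul_mem _ _ hx

/-- Permuting the letters of a word changes it by shorter words only. -/
theorem word_sub_word_mem_of_perm {l l' : List Gen} (h : l.Perm l') :
    word l - word l' ∈ wordSpan (l.length - 1) := by
  induction h with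
  | nil => simp
  | @cons x l₁ l₂ h ih =>
    have e : word (x :: l₁) - word (x :: l₂) = gen x * (word l₁ - word l₂) := by
      simp [word, mul_sub]
    rw [e]
    rcases l₁ with _ | ⟨y, l₁⟩
    · simp [List.nil_perm.mp h]
    · exact gen_mul_mem_wordSpan x ih
  | swap x y l =>
    have e : word (y :: x :: l) - word (x :: y :: l) =
        (gen y * gen x - gen x * gen y) * word l := by
      simp [word, sub_mul, mul_assoc]
    rw [e]
    exact commutator_mul_mem_wordSpan y x (word_mem_wordSpan le_rfl)
  | @trans l₁ l₂ l₃ h₁ _ ih₁ ih₂ =>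
    rw [← sub_add_sub_cancel (word l₁) (word l₂)]
    exact add_mem ih₁ (h₁.length_eq ▸ ih₂)

/-- The ordered word with prescribed multiplicities. -/
def sortedWord (α : Gen → ℕ) : List Gen :=
  List.replicate (α .F) .F ++ (List.replicate (α .Q) .Q ++ (List.replicate (α .H) .H ++
    (List.replicate (α .Z) .Z ++ (List.replicate (α .P) .P ++ List.replicate (α .E) .E))))

/-- The ordered monomial `f^a q^b h^c z^d p^i e^j`. -/
noncomputable def orderedMonomial (α : Gen → ℕ) : U := word (sortedWord α)

theorem perm_sortedWord_count (l : List Gen) : l.Perm (sortedWord fun g => l.count g) := by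
  rw [List.perm_iff_count]
  intro g
  cases g <;> simp [sortedWord, List.count_replicate]

theorem wordSpan_le_span_orderedMonomial (n : ℕ) :
    wordSpan n ≤ Submodule.span ℂ (Set.range orderedMonomial) := by
  have key (l : List Gen) (h : wordSpan (l.length - 1) ≤
      Submodule.span ℂ (Set.range orderedMonomial)) :
      word l ∈ Submodule.span ℂ (Set.range orderedMonomial) := by
    rw [← sub_add_cancel (word l) (orderedMonomial fun g => l.count g)]
    exact add_mem (h (word_sub_word_mem_of_perm (perm_sortedWord_count l)))
      (Submodule.subset_span ⟨_, rfl⟩)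
  induction n with
  | zero =>
    refine Submodule.span_le.mpr ?_
    rintro _ ⟨l, hl, rfl⟩
    obtain rfl : l = [] := by simpa using hl
    exact Submodule.subset_span ⟨0, by simp [orderedMonomial, sortedWord]⟩
  | succ n ih =>
    refine Submodule.span_le.mpr ?_
    rintro _ ⟨l, hl, rfl⟩
    exact key l ((wordSpan_mono (by have : l.length ≤ n + 1 := hl; omega)).trans ih)

theorem span_orderedMonomial : Submodule.span ℂ (Set.range orderedMonomial) = ⊤ := by
  rw [eq_top_iff]
  intro u _
  have hu : u ∈ Algebra.adjoin ℂ (Set.range gen) := by rw [adjoin_range_gen]; trivial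
  rw [← Subalgebra.mem_toSubmodule, Algebra.adjoin_eq_span] at hu
  refine Submodule.span_le.mpr ?_ hu
  intro w hw
  obtain ⟨l, rfl⟩ : ∃ l, word l = w := by
    induction hw using Submonoid.closure_induction with
    | mem x hx => obtain ⟨g, rfl⟩ := hx; exact ⟨[g], by simp [word]⟩
    | one => exact ⟨[], by simp [word]⟩
    | mul x y _ _ hx hy =>
      obtain ⟨l, rfl⟩ := hx
      obtain ⟨l', rfl⟩ := hy
      exact ⟨l ++ l', by simp [word]⟩
  exact wordSpan_le_span_orderedMonomial _ (word_mem_wordSpan le_rfl)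

/-! ### The universal Verma module as differential operators -/

open MvPolynomial

/-- Polynomials in `x, y` (standing for `f, q`) and in the weights `λ(h), λ(z)`. -/
abbrev Pol : Type := MvPolynomial (Fin 4) ℂ

/-- Multiplication by the `i`-th variable. -/
noncomputable def mulX (i : Fin 4) : Module.End ℂ Pol := LinearMap.mulLeft ℂ (X i)

/-- The `i`-th partial derivative. -/
noncomputable def partialX (i : Fin 4) : Module.End ℂ Pol := (pderiv i).toLinearMap

/-- The action of the generators on the universal Verma module. -/
noncomputable def genOp : Gen → Module.End ℂ Pol
  | .F => mulX 0
  | .Q => mulX 1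
  | .H => mulX 2 - ((2 : ℂ) • (mulX 0 * partialX 0) + mulX 1 * partialX 1)
  | .Z => mulX 3
  | .P => mulX 3 * partialX 1 - mulX 1 * partialX 0
  | .E => mulX 2 * partialX 0 - (mulX 1 * partialX 0 * partialX 1 +
      mulX 0 * partialX 0 * partialX 0 - (2⁻¹ : ℂ) • (mulX 3 * partialX 1 * partialX 1))

theorem mulX_apply (i : Fin 4) (g : Pol) : mulX i g = X i * g := rfl

theorem partialX_apply (i : Fin 4) (g : Pol) : partialX i g = pderiv i g := rfl

theorem pderiv_pderiv_comm {σ R : Type*} [CommSemiring R] (i j : σ) (g : MvPolynomial σ R) :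
    pderiv i (pderiv j g) = pderiv j (pderiv i g) := by
  classical
  rcases eq_or_ne i j with rfl | h
  · rfl
  · ext m
    simp only [coeff_pderiv, Finsupp.add_apply, Finsupp.single_eq_of_ne h,
      Finsupp.single_eq_of_ne h.symm, add_zero]
    rw [add_right_comm, mul_right_comm]

theorem genOp_rel {a b : FA} (h : Rel a b) :
    FreeAlgebra.lift ℂ genOp a = FreeAlgebra.lift ℂ genOp b := by
  have comm (g : Pol) : pderiv 1 (pderiv 0 g) = pderiv 0 (pderiv 1 g) := pderiv_pderiv_comm _ _ g
  have hC : (C 2 : Pol) = 2 := map_ofNat C 2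
  have two : (C 2⁻¹ : Pol) * 2 = 1 := by
    rw [← hC, ← C_mul]; simp
  cases h <;> refine LinearMap.ext fun g => ?_ <;>
  simp [ιg, genOp, mulX_apply, partialX_apply, Derivation.leibniz, pderiv_X, comm,
    smul_eq_C_mul, two_mul (FreeAlgebra.ι ℂ _)] <;> clear comm <;> grind

/-- The universal Verma module as a representation of `U`. -/
noncomputable def rep : U →ₐ[ℂ] Module.End ℂ Pol :=
  RingQuot.liftAlgHom ℂ ⟨FreeAlgebra.lift ℂ genOp, fun _ _ h => genOp_rel h⟩

theorem rep_gen (g : Gen) : rep (gen g) = genOp g := by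
  simp [rep, gen, ιg]

/-! ### Annihilators of all Verma modules act by zero on the universal one -/

theorem commute_mulX_rep {i : Fin 4} (h0 : i ≠ 0) (h1 : i ≠ 1) (u : U) :
    Commute (mulX i) (rep u) := by
  have hu : u ∈ Algebra.adjoin ℂ (Set.range gen) := by rw [adjoin_range_gen]; trivial
  induction hu using Algebra.adjoin_induction with
  | mem x hx =>
    obtain ⟨g, rfl⟩ := hx
    rw [rep_gen]
    refine LinearMap.ext fun p => ?_
    cases g <;>
    simp [genOp, mulX_apply, partialX_apply, Derivation.leibniz, pderiv_X_of_ne h0,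
      pderiv_X_of_ne h1, smul_eq_C_mul] <;> ring
  | algebraMap r => rw [AlgHom.commutes]; exact Algebra.commute_algebraMap_right r _
  | add x y _ _ hx hy => rw [map_add]; exact hx.add_right hy
  | mul x y _ _ hx hy => rw [map_mul]; exact hx.mul_right hy

/-- The ideal of `Pol` specialising the generic weight to a given one. -/
noncomputable def weightIdeal (hh zz : ℂ) : Ideal Pol := Ideal.span {X 2 - C hh, X 3 - C zz}

theorem rep_mem_weightIdeal {hh zz : ℂ} (u : U) {g : Pol} (hg : g ∈ weightIdeal hh zz) :
    rep u g ∈ weightIdeal hh zz := by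
  obtain ⟨a, b, rfl⟩ := Ideal.mem_span_pair.mp hg
  have hX (i : Fin 4) (h0 : i ≠ 0) (h1 : i ≠ 1) (p : Pol) (c : ℂ) :
      rep u (p * (X i - C c)) = rep u p * (X i - C c) := by
    have h := LinearMap.congr_fun (commute_mulX_rep h0 h1 u) p
    simp only [Module.End.mul_apply, mulX_apply] at h
    rw [mul_sub, mul_comm p, mul_comm p, ← smul_eq_C_mul, map_sub, ← h, map_smul, smul_eq_C_mul]
    ring
  rw [map_add, hX 2 (by decide) (by decide), hX 3 (by decide) (by decide)]
  exact Ideal.mem_span_pair.mpr ⟨_, _, rfl⟩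

theorem rep_one_mem_weightIdeal {hh zz : ℂ} {w : U} (hw : w ∈ vermaIdeal hh zz) :
    rep w 1 ∈ weightIdeal hh zz := by
  induction hw using Submodule.span_induction with
  | mem x hx =>
    rcases hx with rfl | rfl | rfl | rfl
    · simp [E, rep_gen, genOp, mulX_apply, partialX_apply]
    · simp [P, rep_gen, genOp, mulX_apply, partialX_apply]
    · have h : rep (H - sc hh) 1 = X 2 - C hh := by
        simp [H, sc, rep_gen, genOp, mulX_apply, partialX_apply, smul_eq_C_mul,
          Module.algebraMap_end_apply]
      rw [h]
      exact Ideal.subset_span (by simp)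
    · have h : rep (Z - sc zz) 1 = X 3 - C zz := by
        simp [Z, sc, rep_gen, genOp, mulX_apply, smul_eq_C_mul, Module.algebraMap_end_apply]
      rw [h]
      exact Ideal.subset_span (by simp)
  | zero => simp
  | add x y _ _ hx hy => rw [map_add]; exact add_mem hx hy
  | smul a x _ hx =>
    rw [smul_eq_mul, map_mul]
    exact rep_mem_weightIdeal a hx

theorem rep_apply_eq_zero {u : U} (hu : ∀ hh zz : ℂ, ∀ v : Verma hh zz, u • v = 0) (w : U) :
    rep u (rep w 1) = 0 := by
  refine MvPolynomial.funext fun p => ?_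
  have h : u * w ∈ vermaIdeal (p 2) (p 3) :=
    (Submodule.Quotient.mk_eq_zero _).mp (hu (p 2) (p 3) (Submodule.Quotient.mk w))
  have h' := rep_one_mem_weightIdeal h
  rw [map_mul] at h'
  obtain ⟨a, b, hab⟩ := Ideal.mem_span_pair.mp h'
  rw [← Module.End.mul_apply, ← hab]
  simp

/-! ### Leading symbols with respect to the weight -/

/-- The weighted degree of an exponent, with the variables for `λ(h), λ(z)` in degrees `2, 1`. -/
def weightDeg (s : Fin 4 →₀ ℕ) : ℕ := 2 * s 2 + s 3

/-- Polynomials of weighted degree less than `n`. -/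
def lowDeg (n : ℕ) : Submodule ℂ Pol where
  carrier := {g | ∀ s, n ≤ weightDeg s → coeff s g = 0}
  zero_mem' := fun _ _ => by simp
  add_mem' := fun ha hb s hs => by rw [coeff_add, ha s hs, hb s hs, add_zero]
  smul_mem' := fun c g hg s hs => by rw [coeff_smul, hg s hs, smul_zero]

theorem lowDeg_mono {m n : ℕ} (h : m ≤ n) : lowDeg m ≤ lowDeg n :=
  fun _ hg s hs => hg s (h.trans hs)

theorem mulX_mem_lowDeg (i : Fin 4) {n : ℕ} {g : Pol} (hg : g ∈ lowDeg n) :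
    mulX i g ∈ lowDeg (n + weightDeg (Finsupp.single i 1)) := by
  intro s hs
  rw [mulX_apply, coeff_X_mul']
  split_ifs with h
  · refine hg _ ?_
    have hle : Finsupp.single i 1 ≤ s := by
      rw [Finsupp.single_le_iff]
      exact Nat.one_le_iff_ne_zero.mpr (Finsupp.mem_support_iff.mp h)
    have h2 := hle 2
    have h3 := hle 3
    simp only [weightDeg, Finsupp.tsub_apply] at hs ⊢
    omega
  · rfl

theorem partialX_mem_lowDeg (i : Fin 4) {n : ℕ} {g : Pol} (hg : g ∈ lowDeg n) :
    partialX i g ∈ lowDeg n := by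
  intro s hs
  rw [partialX_apply, coeff_pderiv, hg, zero_mul]
  simp only [weightDeg, Finsupp.add_apply] at hs ⊢
  omega

/-- `T₀` has degree at most `k` and agrees with `T` up to operators of smaller degree. -/
def HasSymbol (T T₀ : Module.End ℂ Pol) (k : ℕ) : Prop :=
  (∀ n, ∀ g ∈ lowDeg n, T₀ g ∈ lowDeg (n + k)) ∧
    ∀ n, ∀ g ∈ lowDeg (n + 1), T g - T₀ g ∈ lowDeg (n + k)

theorem HasSymbol.one : HasSymbol 1 1 0 :=
  ⟨fun _ _ hg => hg, fun n g _ => by simp⟩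

theorem HasSymbol.mul {S S₀ T T₀ : Module.End ℂ Pol} {k l : ℕ} (hS : HasSymbol S S₀ k)
    (hT : HasSymbol T T₀ l) : HasSymbol (S * T) (S₀ * T₀) (k + l) := by
  refine ⟨fun n g hg => ?_, fun n g hg => ?_⟩
  · have h := hS.1 _ _ (hT.1 n g hg)
    rwa [add_assoc, add_comm l] at h
  · have h₁ := hS.2 (n + l) (T₀ g) (by have := hT.1 _ g hg; rwa [add_right_comm] at this)
    have h₂ := hT.2 n g hg
    have h₃ := hS.1 _ _ h₂
    have h₄ := hS.2 (n + l) _ (lowDeg_mono (Nat.le_succ _) h₂)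
    have e : (S * T) g - (S₀ * T₀) g =
        (S (T g - T₀ g) - S₀ (T g - T₀ g)) + S₀ (T g - T₀ g) + (S (T₀ g) - S₀ (T₀ g)) := by
      simp only [Module.End.mul_apply, map_sub]; abel
    rw [e, add_comm k, ← add_assoc]
    exact add_mem (add_mem h₄ h₃) h₁

/-- The degree of the leading symbol of a generator. -/
def genDeg : Gen → ℕ
  | .F => 0
  | .Q => 0
  | .H => 2
  | .Z => 1
  | .P => 1
  | .E => 2

/-- The leading symbol of a generator. -/
noncomputable def genSymbol : Gen → Module.End ℂ Pol
  | .F => mulX 0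
  | .Q => mulX 1
  | .H => mulX 2
  | .Z => mulX 3
  | .P => mulX 3 * partialX 1
  | .E => mulX 2 * partialX 0

theorem hasSymbol_genOp (g : Gen) : HasSymbol (genOp g) (genSymbol g) (genDeg g) := by
  have m0 {n : ℕ} {p : Pol} (h : p ∈ lowDeg n) : mulX 0 p ∈ lowDeg n := by
    simpa [weightDeg] using mulX_mem_lowDeg 0 h
  have m1 {n : ℕ} {p : Pol} (h : p ∈ lowDeg n) : mulX 1 p ∈ lowDeg n := by
    simpa [weightDeg] using mulX_mem_lowDeg 1 h
  have m2 {n : ℕ} {p : Pol} (h : p ∈ lowDeg n) : mulX 2 p ∈ lowDeg (n + 2) := by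
    simpa [weightDeg] using mulX_mem_lowDeg 2 h
  have m3 {n : ℕ} {p : Pol} (h : p ∈ lowDeg n) : mulX 3 p ∈ lowDeg (n + 1) := by
    simpa [weightDeg] using mulX_mem_lowDeg 3 h
  have d (i : Fin 4) {n : ℕ} {p : Pol} (h : p ∈ lowDeg n) : partialX i p ∈ lowDeg n :=
    partialX_mem_lowDeg i h
  cases g <;> refine ⟨fun n p hp => ?_, fun n p hp => ?_⟩ <;>
    simp only [genOp, genSymbol, genDeg, Module.End.mul_apply, LinearMap.sub_apply,
      LinearMap.add_apply, LinearMap.smul_apply, sub_self, zero_mem, sub_sub_cancel_left,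
      neg_mem_iff, add_zero]
  · exact m2 (d 0 hp)
  · exact sub_mem (add_mem (lowDeg_mono (by omega) (m1 (d 0 (d 1 hp))))
      (lowDeg_mono (by omega) (m0 (d 0 (d 0 hp))))) (Submodule.smul_mem _ _ (m3 (d 1 (d 1 hp))))
  · exact m2 hp
  · exact lowDeg_mono (by omega)
      (add_mem (Submodule.smul_mem _ _ (m0 (d 0 hp))) (m1 (d 1 hp)))
  · exact m0 hp
  · exact m3 (d 1 hp)
  · exact m1 (d 0 hp)
  · exact m1 hp
  · exact m3 hp

/-- The leading symbol of a word. -/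
noncomputable def wordSymbol (l : List Gen) : Module.End ℂ Pol := (l.map genSymbol).prod

theorem hasSymbol_rep_word (l : List Gen) :
    HasSymbol (rep (word l)) (wordSymbol l) (l.map genDeg).sum := by
  induction l with
  | nil => simpa [word, wordSymbol] using HasSymbol.one
  | cons g l ih =>
    simpa [word, wordSymbol, rep_gen] using (hasSymbol_genOp g).mul ih

/-- The exponent with the given entries. -/
noncomputable def expo (a b c d : ℕ) : Fin 4 →₀ ℕ := Finsupp.equivFunOnFinite.symm ![a, b, c, d]

theorem expo_apply (a b c d : ℕ) (i : Fin 4) : expo a b c d i = ![a, b, c, d] i := rfl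

theorem mulX_monomial (i : Fin 4) (s : Fin 4 →₀ ℕ) (r : ℂ) :
    mulX i (monomial s r) = monomial (s + Finsupp.single i 1) r := by
  rw [mulX_apply, X, monomial_mul, one_mul, add_comm]

theorem partialX_monomial (i : Fin 4) (s : Fin 4 →₀ ℕ) (r : ℂ) :
    partialX i (monomial s r) = monomial (s - Finsupp.single i 1) (r * s i) := by
  rw [partialX_apply, pderiv_monomial]

theorem mulX_pow_monomial (i : Fin 4) (n : ℕ) (s : Fin 4 →₀ ℕ) (r : ℂ) :
    (mulX i ^ n) (monomial s r) = monomial (s + Finsupp.single i n) r := by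
  induction n with
  | zero => simp
  | succ n ih => rw [pow_succ', Module.End.mul_apply, ih, mulX_monomial, Finsupp.single_add,
      add_assoc]

theorem mulX_partialX_pow_monomial {i k : Fin 4} (h : i ≠ k) (n : ℕ) (s : Fin 4 →₀ ℕ) (r : ℂ) :
    ((mulX i * partialX k) ^ n) (monomial s r) =
      monomial (s - Finsupp.single k n + Finsupp.single i n) (r * (s k).descFactorial n) := by
  induction n with
  | zero => simp
  | succ n ih =>
    rw [pow_succ', Module.End.mul_apply, ih, Module.End.mul_apply, partialX_monomial,
      mulX_monomial]
    refine congrArg₂ (fun s r => monomial s r) ?_ ?_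
    · ext x
      by_cases hi : x = i
      · subst hi; simp [Finsupp.single_eq_of_ne h]; omega
      · simp [Finsupp.single_eq_of_ne hi]; omega
    · simp [Finsupp.single_eq_of_ne h.symm, Nat.descFactorial_succ]; ring

theorem wordSymbol_sortedWord_monomial (α : Gen → ℕ) (m n : ℕ) :
    wordSymbol (sortedWord α) (monomial (expo m n 0 0) 1) =
      monomial (expo (m - α .E + α .F) (n - α .P + α .Q) (α .E + α .H) (α .P + α .Z))
        ((m.descFactorial (α .E) * n.descFactorial (α .P) : ℕ) : ℂ) := by
  simp only [wordSymbol, sortedWord, List.map_append, List.map_replicate, List.prod_append,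
    List.prod_replicate, genSymbol, Module.End.mul_apply, mulX_pow_monomial,
    mulX_partialX_pow_monomial (show (2 : Fin 4) ≠ 0 by decide),
    mulX_partialX_pow_monomial (show (3 : Fin 4) ≠ 1 by decide)]
  refine congrArg₂ (fun s r => monomial s r) ?_ ?_
  · ext x
    fin_cases x <;> simp [expo_apply]
  · simp [expo_apply]

/-- The degree of the leading symbol of an ordered monomial. -/
def monomialDeg (α : Gen → ℕ) : ℕ := 2 * (α .E + α .H) + (α .P + α .Z)

theorem coeff_rep_orderedMonomial (α : Gen → ℕ) (m n : ℕ) {s : Fin 4 →₀ ℕ}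
    (hs : monomialDeg α ≤ weightDeg s) :
    coeff s (rep (orderedMonomial α) (monomial (expo m n 0 0) 1)) =
      coeff s (wordSymbol (sortedWord α) (monomial (expo m n 0 0) 1)) := by
  have hg : (monomial (expo m n 0 0) 1 : Pol) ∈ lowDeg (0 + 1) := by
    intro t ht
    rw [coeff_monomial, if_neg]
    rintro rfl
    simp [weightDeg, expo] at ht
  have h := (hasSymbol_rep_word (sortedWord α)).2 0 _ hg s (by
    refine le_trans (le_of_eq ?_) hs
    simp [sortedWord, genDeg, monomialDeg]; ring)
  rwa [coeff_sub, sub_eq_zero] at h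

theorem rep_pow_mul_pow_one (m n : ℕ) :
    rep (F ^ m * Q ^ n) 1 = monomial (expo m n 0 0) 1 := by
  rw [map_mul, map_pow, map_pow, F, Q, rep_gen, rep_gen, Module.End.mul_apply,
    show (1 : Pol) = monomial 0 1 from rfl]
  simp only [genOp, mulX_pow_monomial]
  congr 2
  ext x
  fin_cases x <;> simp [expo]

/-- A nonzero combination of ordered monomials acts nontrivially on some `x ^ m * y ^ n`. -/
theorem exists_rep_ne_zero {c : (Gen → ℕ) →₀ ℂ} (hc : c ≠ 0) :
    ∃ m n : ℕ, rep (Finsupp.linearCombination ℂ orderedMonomial c)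
      (monomial (expo m n 0 0) 1) ≠ 0 := by
  obtain ⟨β, hβ, hβmax⟩ := Finset.exists_max_image c.support monomialDeg
    (Finsupp.support_nonempty_iff.mpr hc)
  obtain ⟨α, hα, hαmin⟩ := Finset.exists_min_image
    (c.support.filter fun γ => monomialDeg γ = monomialDeg β) (fun γ => γ .E + γ .P)
    ⟨β, Finset.mem_filter.mpr ⟨hβ, rfl⟩⟩
  obtain ⟨hαc, hαβ⟩ := Finset.mem_filter.mp hα
  refine ⟨α .E, α .P, fun h => ?_⟩
  set s := expo (α .F) (α .Q) (α .E + α .H) (α .P + α .Z) with hs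
  have hsdeg : weightDeg s = monomialDeg α := by simp [hs, weightDeg, expo, monomialDeg]
  have hcoeff (γ : Gen → ℕ) (hγ : γ ∈ c.support) (hne : γ ≠ α) :
      coeff s (rep (orderedMonomial γ) (monomial (expo (α .E) (α .P) 0 0) 1)) = 0 := by
    have hle := hβmax γ hγ
    rw [coeff_rep_orderedMonomial γ _ _ (by rw [hsdeg, hαβ]; exact hle),
      wordSymbol_sortedWord_monomial, coeff_monomial]
    split_ifs with heq
    · have hx (i : Fin 4) := DFunLike.congr_fun heq i
      have h0 := hx 0
      have h1 := hx 1
      have h2 := hx 2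
      have h3 := hx 3
      simp only [hs, expo, Finsupp.equivFunOnFinite_symm_apply_apply, Matrix.cons_val] at h0 h1 h2 h3
      have hmin := hαmin γ (Finset.mem_filter.mpr ⟨hγ, by
        rw [← hαβ]; simp only [monomialDeg, h2, h3]⟩)
      by_contra hne0
      rw [Nat.cast_eq_zero, mul_eq_zero, not_or, Nat.descFactorial_eq_zero_iff_lt,
        Nat.descFactorial_eq_zero_iff_lt] at hne0
      refine hne (_root_.funext fun x => ?_)
      cases x <;> omega
    · rfl
  have hlead : coeff s (rep (orderedMonomial α) (monomial (expo (α .E) (α .P) 0 0) 1)) ≠ 0 := by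
    rw [coeff_rep_orderedMonomial α _ _ hsdeg.ge, wordSymbol_sortedWord_monomial, coeff_monomial,
      if_pos (by simp [hs])]
    simp [Nat.descFactorial_self, Nat.factorial_ne_zero]
  have h' := congrArg (coeff s) h
  rw [Finsupp.linearCombination_apply, Finsupp.sum, map_sum, LinearMap.sum_apply, coeff_sum,
    Finset.sum_eq_single_of_mem α hαc fun γ hγ hne => by
      rw [map_smul, LinearMap.smul_apply, coeff_smul, hcoeff γ hγ hne, smul_zero],
    map_smul, LinearMap.smul_apply, coeff_smul, coeff_zero, smul_eq_mul] at h'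
  exact mul_ne_zero (Finsupp.mem_support_iff.mp hαc) hlead h'

/-- Proposition 21 of the paper: the intersection over all
`λ ∈ 𝔥*` of the annihilators of the Verma modules `Δ(λ)` is zero. -/
theorem iInf_verma_annihilator_eq_bot (u : U)
    (hu : ∀ hh zz : ℂ, ∀ v : Verma hh zz, u • v = 0) : u = 0 := by
  have hspan : u ∈ Submodule.span ℂ (Set.range orderedMonomial) := by
    rw [span_orderedMonomial]; trivial
  obtain ⟨c, rfl⟩ := (Finsupp.mem_span_range_iff_exists_finsupp).mp hspan
  by_contra h
  have hc : c ≠ 0 := by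
    rintro rfl
    simp at h
  obtain ⟨m, n, hmn⟩ := exists_rep_ne_zero hc
  rw [← rep_pow_mul_pow_one] at hmn
  exact hmn (rep_apply_eq_zero hu _)

end Schrodinger
end

section
/- The center of the universal enveloping algebra of the Schrödinger algebra is the polynomial subalgebra generated by z and c, i.e. Z(s) = ℂ[z, c], where c = (h²+h+4fe)z - 2(fp² - eq² - hpq). -/
namespace Schrodinger

noncomputable section

section

open MvPolynomial

/-- The universal property of `U`, with the defining relations spelled out. -/
theorem exists_algHom {A : Type*} [Ring A] [Algebra ℂ A] (e h f p q z : A)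
    (he : h * e = e * h + 2 * e) (ef : e * f = f * e + h) (hf : h * f = f * h - 2 * f)
    (eq : e * q = q * e + p) (ep : e * p = p * e) (hp : h * p = p * h + p)
    (fp : f * p = p * f + q) (fq : f * q = q * f) (hq : h * q = q * h - q)
    (pq : p * q = q * p + z) (ze : z * e = e * z) (zh : z * h = h * z) (zf : z * f = f * z)
    (zp : z * p = p * z) (zq : z * q = q * z) :
    ∃ φ : U →ₐ[ℂ] A, φ E = e ∧ φ H = h ∧ φ F = f ∧ φ P = p ∧ φ Q = q ∧ φ Z = z := by
  let g : Gen → A := fun x => match x with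
    | .E => e | .H => h | .F => f | .P => p | .Q => q | .Z => z
  have hg : ∀ ⦃x y : FA⦄, Rel x y → FreeAlgebra.lift ℂ g x = FreeAlgebra.lift ℂ g y := by
    intro x y hxy
    have h2 : FreeAlgebra.lift ℂ g (2 : FA) = 2 := map_ofNat (FreeAlgebra.lift ℂ g) 2
    cases hxy <;>
      simp only [ιg, map_mul, map_add, map_sub, FreeAlgebra.lift_ι_apply, h2] <;> assumption
  refine ⟨RingQuot.liftAlgHom ℂ ⟨FreeAlgebra.lift ℂ g, hg⟩, ?_, ?_, ?_, ?_, ?_, ?_⟩ <;>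
    simp [E, H, F, P, Q, Z, gen, ιg, g]

theorem gen_rel {x y : FA} (h : Rel x y) :
    RingQuot.mkAlgHom ℂ Rel x = RingQuot.mkAlgHom ℂ Rel y :=
  RingQuot.mkAlgHom_rel ℂ h

theorem mkAlgHom_two : RingQuot.mkAlgHom ℂ Rel (2 : FA) = 2 :=
  map_ofNat (RingQuot.mkAlgHom ℂ Rel) 2

theorem H_mul_E : H * E = E * H + 2 * E := by simpa [H, E, gen, mkAlgHom_two] using gen_rel Rel.he
theorem E_mul_F : E * F = F * E + H := by simpa [E, F, H, gen] using gen_rel Rel.ef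
theorem H_mul_F : H * F = F * H - 2 * F := by simpa [F, H, gen, mkAlgHom_two] using gen_rel Rel.hf
theorem E_mul_Q : E * Q = Q * E + P := by simpa [E, P, Q, gen] using gen_rel Rel.eq
theorem E_mul_P : E * P = P * E := by simpa [E, P, gen] using gen_rel Rel.ep
theorem H_mul_P : H * P = P * H + P := by simpa [H, P, gen] using gen_rel Rel.hp
theorem F_mul_P : F * P = P * F + Q := by simpa [F, P, Q, gen] using gen_rel Rel.fp
theorem F_mul_Q : F * Q = Q * F := by simpa [F, Q, gen] using gen_rel Rel.fq
theorem H_mul_Q : H * Q = Q * H - Q := by simpa [H, Q, gen] using gen_rel Rel.hq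
theorem P_mul_Q : P * Q = Q * P + Z := by simpa [P, Q, Z, gen] using gen_rel Rel.pq
theorem Z_mul_E : Z * E = E * Z := by simpa [E, Z, gen] using gen_rel Rel.ze
theorem Z_mul_H : Z * H = H * Z := by simpa [H, Z, gen] using gen_rel Rel.zh
theorem Z_mul_F : Z * F = F * Z := by simpa [F, Z, gen] using gen_rel Rel.zf
theorem Z_mul_P : Z * P = P * Z := by simpa [P, Z, gen] using gen_rel Rel.zp
theorem Z_mul_Q : Z * Q = Q * Z := by simpa [Q, Z, gen] using gen_rel Rel.zq

/-- Induction principle: a linear subspace containing `1` and stable under left multiplication by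
the generators is everything. -/
theorem mem_of_left_stable (S : Submodule ℂ U) (h1 : (1 : U) ∈ S)
    (hE : ∀ x ∈ S, E * x ∈ S) (hH : ∀ x ∈ S, H * x ∈ S) (hF : ∀ x ∈ S, F * x ∈ S)
    (hP : ∀ x ∈ S, P * x ∈ S) (hQ : ∀ x ∈ S, Q * x ∈ S) (hZ : ∀ x ∈ S, Z * x ∈ S) (u : U) :
    u ∈ S := by
  obtain ⟨a, rfl⟩ := RingQuot.mkAlgHom_surjective ℂ Rel u
  have key : ∀ x ∈ S, RingQuot.mkAlgHom ℂ Rel a * x ∈ S := by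
    induction a using FreeAlgebra.induction with
    | grade0 r =>
      intro x hx
      rw [AlgHom.commutes, ← Algebra.smul_def]
      exact S.smul_mem r hx
    | grade1 g => cases g <;> assumption
    | mul a b ha hb =>
      intro x hx
      rw [map_mul, mul_assoc]
      exact ha _ (hb x hx)
    | add a b ha hb =>
      intro x hx
      rw [map_add, add_mul]
      exact S.add_mem (ha x hx) (hb x hx)
  simpa using key 1 h1

/-- The commutative polynomial ring underlying the Verma modules. -/
abbrev PolyFQ : Type := MvPolynomial (Fin 2) ℂ

theorem pderiv_one_pderiv_zero (m : PolyFQ) :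
    pderiv 1 (pderiv 0 m) = pderiv 0 (pderiv 1 m) := by
  induction m using MvPolynomial.induction_on with
  | C a => simp
  | add p q hp hq => simp [hp, hq]
  | mul_X p i hp => fin_cases i <;> simp [Derivation.leibniz, hp, pderiv_X, add_comm]

theorem pderiv_ofNat (i : Fin 2) : pderiv i (2 : PolyFQ) = 0 := pderiv_C (a := (2 : ℂ))

theorem exists_vermaHom (a t : ℂ) : ∃ φ : U →ₐ[ℂ] Module.End ℂ PolyFQ,
    ∀ m : PolyFQ,
      φ E m = C a * pderiv 0 m - X 1 * pderiv 1 (pderiv 0 m) - X 0 * pderiv 0 (pderiv 0 m)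
        + C (t / 2) * pderiv 1 (pderiv 1 m) ∧
      φ H m = C a * m - 2 * X 0 * pderiv 0 m - X 1 * pderiv 1 m ∧
      φ F m = X 0 * m ∧
      φ P m = C t * pderiv 1 m - X 1 * pderiv 0 m ∧
      φ Q m = X 1 * m ∧
      φ Z m = C t * m := by
  let μ : PolyFQ → Module.End ℂ PolyFQ := LinearMap.mulLeft ℂ
  let d (i : Fin 2) : Module.End ℂ PolyFQ := (pderiv i).toLinearMap
  have hμ (x m : PolyFQ) : μ x m = x * m := rfl
  have hd (i : Fin 2) (m : PolyFQ) : d i m = pderiv i m := rfl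
  have ht : (C t : PolyFQ) = 2 * C (t / 2) := by
    rw [show (2 : PolyFQ) = C 2 from rfl, ← C_mul]; congr 1; ring
  have h2 (m : PolyFQ) : (2 : Module.End ℂ PolyFQ) m = 2 * m := by
    rw [show (2 : Module.End ℂ PolyFQ) = 1 + 1 from one_add_one_eq_two.symm, two_mul]
    rfl
  obtain ⟨φ, h⟩ : ∃ φ : U →ₐ[ℂ] Module.End ℂ PolyFQ, _ := by
    refine exists_algHom
      (μ (C a) * d 0 - μ (X 1) * d 1 * d 0 - μ (X 0) * d 0 * d 0 + μ (C (t / 2)) * d 1 * d 1)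
      (μ (C a) - μ (2 * X 0) * d 0 - μ (X 1) * d 1) (μ (X 0)) (μ (C t) * d 1 - μ (X 1) * d 0)
      (μ (X 1)) (μ (C t)) ?_ ?_ ?_ ?_ ?_ ?_ ?_ ?_ ?_ ?_ ?_ ?_ ?_ ?_ ?_ <;>
    · refine LinearMap.ext fun m => ?_
      simp [hμ, hd, h2, Derivation.leibniz, pderiv_X, pderiv_one_pderiv_zero, pderiv_ofNat, ht]
      try ring
  refine ⟨φ, fun m => ?_⟩
  obtain ⟨h1, h2, h3, h4, h5, h6⟩ := h
  rw [h1, h2, h3, h4, h5, h6]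
  simp [hμ, hd]

/-- The Verma module with highest weight `(a, t)`, realized by differential operators on the
polynomial ring in `f` and `q`. -/
def vermaRep (a t : ℂ) : U →ₐ[ℂ] Module.End ℂ PolyFQ := (exists_vermaHom a t).choose

section vermaRep

variable (a t : ℂ) (m : PolyFQ)

theorem vermaRep_E : vermaRep a t E m = C a * pderiv 0 m - X 1 * pderiv 1 (pderiv 0 m)
    - X 0 * pderiv 0 (pderiv 0 m) + C (t / 2) * pderiv 1 (pderiv 1 m) :=
  ((exists_vermaHom a t).choose_spec m).1

theorem vermaRep_H : vermaRep a t H m = C a * m - 2 * X 0 * pderiv 0 m - X 1 * pderiv 1 m :=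
  ((exists_vermaHom a t).choose_spec m).2.1

theorem vermaRep_F : vermaRep a t F m = X 0 * m :=
  ((exists_vermaHom a t).choose_spec m).2.2.1

theorem vermaRep_P : vermaRep a t P m = C t * pderiv 1 m - X 1 * pderiv 0 m :=
  ((exists_vermaHom a t).choose_spec m).2.2.2.1

theorem vermaRep_Q : vermaRep a t Q m = X 1 * m :=
  ((exists_vermaHom a t).choose_spec m).2.2.2.2.1

theorem vermaRep_Z : vermaRep a t Z m = C t * m :=
  ((exists_vermaHom a t).choose_spec m).2.2.2.2.2

end vermaRep

/-- The ordered monomial `f^m₀ q^m₁ h^m₂ z^m₃`. -/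
def lowerMonomial (m : Fin 4 →₀ ℕ) : U := F ^ m 0 * Q ^ m 1 * H ^ m 2 * Z ^ m 3

/-- The linear map sending a polynomial in `f, q, h, z` to its ordered evaluation in `U`. -/
def lower : MvPolynomial (Fin 4) ℂ →ₗ[ℂ] U := (basisMonomials (Fin 4) ℂ).constr ℂ lowerMonomial

theorem lower_monomial (m : Fin 4 →₀ ℕ) (r : ℂ) :
    lower (monomial m r) = r • lowerMonomial m := by
  have h : lower (monomial m 1) = lowerMonomial m := by
    simpa only [coe_basisMonomials] using!
      (basisMonomials (Fin 4) ℂ).constr_basis ℂ lowerMonomial m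
  rw [← h, ← map_smul, smul_monomial, smul_eq_mul, mul_one]

/-- The linear map sending a family `g` of polynomials in `f, q, h, z` to the ordered sum
`∑ g(i, j)(f, q, h, z) e^i p^j`. -/
def normalForm : ((ℕ × ℕ) →₀ MvPolynomial (Fin 4) ℂ) →ₗ[ℂ] U :=
  Finsupp.lsum ℂ fun ij => (LinearMap.mulRight ℂ (E ^ ij.1 * P ^ ij.2)).comp lower

theorem normalForm_apply (G : (ℕ × ℕ) →₀ MvPolynomial (Fin 4) ℂ) :
    normalForm G = G.sum fun ij g => lower g * (E ^ ij.1 * P ^ ij.2) := by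
  rfl

/-- The span of the ordered monomials. -/
def orderedSpan : Submodule ℂ U :=
  Submodule.span ℂ {x | ∃ a b c d i j : ℕ,
    x = F ^ a * (Q ^ b * (H ^ c * (Z ^ d * (E ^ i * P ^ j))))}

theorem mem_orderedSpan (a b c d i j : ℕ) :
    F ^ a * (Q ^ b * (H ^ c * (Z ^ d * (E ^ i * P ^ j)))) ∈ orderedSpan :=
  Submodule.subset_span ⟨a, b, c, d, i, j, rfl⟩

theorem mul_mem_orderedSpan {g : U}
    (hg : ∀ a b c d i j : ℕ,
      g * (F ^ a * (Q ^ b * (H ^ c * (Z ^ d * (E ^ i * P ^ j))))) ∈ orderedSpan) :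
    ∀ x ∈ orderedSpan, g * x ∈ orderedSpan := by
  intro x hx
  induction hx using Submodule.span_induction with
  | mem x hx =>
    obtain ⟨a, b, c, d, i, j, rfl⟩ := hx
    exact hg a b c d i j
  | zero => simp
  | add x y _ _ hx hy => rw [mul_add]; exact add_mem hx hy
  | smul r x _ hx => rw [mul_smul_comm]; exact Submodule.smul_mem _ r hx

theorem F_mul_mem : ∀ x ∈ orderedSpan, F * x ∈ orderedSpan := by
  refine mul_mem_orderedSpan fun a b c d i j => ?_
  rw [← mul_assoc, ← pow_succ']
  exact mem_orderedSpan (a + 1) b c d i j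

theorem Q_mul_mem : ∀ x ∈ orderedSpan, Q * x ∈ orderedSpan := by
  refine mul_mem_orderedSpan fun a b c d i j => ?_
  have h : Commute Q F := F_mul_Q.symm
  rw [(h.pow_right a).left_comm, ← mul_assoc Q, ← pow_succ']
  exact mem_orderedSpan a (b + 1) c d i j

theorem Z_mul_mem : ∀ x ∈ orderedSpan, Z * x ∈ orderedSpan := by
  refine mul_mem_orderedSpan fun a b c d i j => ?_
  have hF : Commute Z F := Z_mul_F
  have hQ : Commute Z Q := Z_mul_Q
  have hH : Commute Z H := Z_mul_H
  rw [(hF.pow_right a).left_comm, (hQ.pow_right b).left_comm, (hH.pow_right c).left_comm,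
    ← mul_assoc Z, ← pow_succ']
  exact mem_orderedSpan a b c (d + 1) i j

theorem two_mul_mem {x : U} (hx : x ∈ orderedSpan) : 2 * x ∈ orderedSpan := by
  rw [two_mul]; exact add_mem hx hx

theorem H_mul_mem : ∀ x ∈ orderedSpan, H * x ∈ orderedSpan := by
  refine mul_mem_orderedSpan fun a b c d i j => ?_
  induction a with
  | succ a ih =>
    have h : ∀ x, H * (F * x) = F * (H * x) - 2 * (F * x) := fun x => by
      rw [← mul_assoc, H_mul_F]; simp [sub_mul, mul_assoc]
    rw [pow_succ', mul_assoc F, h]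
    exact sub_mem (F_mul_mem _ ih) (two_mul_mem (F_mul_mem _ (mem_orderedSpan a b c d i j)))
  | zero =>
    simp only [pow_zero, one_mul]
    induction b with
    | succ b ih =>
      have h : ∀ x, H * (Q * x) = Q * (H * x) - Q * x := fun x => by
        rw [← mul_assoc, H_mul_Q]; simp [sub_mul, mul_assoc]
      rw [pow_succ', mul_assoc Q, h]
      exact sub_mem (Q_mul_mem _ ih) (Q_mul_mem _ (by simpa using mem_orderedSpan 0 b c d i j))
    | zero =>
      rw [pow_zero, one_mul, ← mul_assoc, ← pow_succ']
      simpa using mem_orderedSpan 0 0 (c + 1) d i j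

theorem P_mul_mem : ∀ x ∈ orderedSpan, P * x ∈ orderedSpan := by
  refine mul_mem_orderedSpan fun a b c d i j => ?_
  induction a with
  | succ a ih =>
    have h : ∀ x, P * (F * x) = F * (P * x) - Q * x := fun x => by
      rw [← mul_assoc F, F_mul_P]; simp [add_mul, mul_assoc]
    rw [pow_succ', mul_assoc F, h]
    exact sub_mem (F_mul_mem _ ih) (Q_mul_mem _ (mem_orderedSpan a b c d i j))
  | zero =>
    simp only [pow_zero, one_mul]
    induction b with
    | succ b ih =>
      have h : ∀ x, P * (Q * x) = Q * (P * x) + Z * x := fun x => by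
        rw [← mul_assoc, P_mul_Q]; simp [add_mul, mul_assoc]
      rw [pow_succ', mul_assoc Q, h]
      exact add_mem (Q_mul_mem _ ih) (Z_mul_mem _ (by simpa using mem_orderedSpan 0 b c d i j))
    | zero =>
      simp only [pow_zero, one_mul]
      induction c with
      | succ c ih =>
        have h : ∀ x, P * (H * x) = H * (P * x) - P * x := fun x => by
          rw [← mul_assoc H, H_mul_P]; simp [add_mul, mul_assoc]
        rw [pow_succ', mul_assoc H, h]
        exact sub_mem (H_mul_mem _ ih) ih
      | zero =>
        have hZ : Commute P Z := Z_mul_P.symm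
        have hE : Commute P E := E_mul_P.symm
        rw [pow_zero, one_mul, (hZ.pow_right d).left_comm, (hE.pow_right i).left_comm, ← pow_succ']
        simpa using mem_orderedSpan 0 0 0 d i (j + 1)

theorem E_mul_mem : ∀ x ∈ orderedSpan, E * x ∈ orderedSpan := by
  refine mul_mem_orderedSpan fun a b c d i j => ?_
  induction a with
  | succ a ih =>
    have h : ∀ x, E * (F * x) = F * (E * x) + H * x := fun x => by
      rw [← mul_assoc, E_mul_F]; simp [add_mul, mul_assoc]
    rw [pow_succ', mul_assoc F, h]
    exact add_mem (F_mul_mem _ ih) (H_mul_mem _ (mem_orderedSpan a b c d i j))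
  | zero =>
    simp only [pow_zero, one_mul]
    induction b with
    | succ b ih =>
      have h : ∀ x, E * (Q * x) = Q * (E * x) + P * x := fun x => by
        rw [← mul_assoc, E_mul_Q]; simp [add_mul, mul_assoc]
      rw [pow_succ', mul_assoc Q, h]
      exact add_mem (Q_mul_mem _ ih) (P_mul_mem _ (by simpa using mem_orderedSpan 0 b c d i j))
    | zero =>
      simp only [pow_zero, one_mul]
      induction c with
      | succ c ih =>
        have h : ∀ x, E * (H * x) = H * (E * x) - 2 * (E * x) := fun x => by
          rw [← mul_assoc H, H_mul_E]; simp [add_mul, mul_assoc]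
        rw [pow_succ', mul_assoc H, h]
        exact sub_mem (H_mul_mem _ ih) (two_mul_mem ih)
      | zero =>
        have hZ : Commute E Z := Z_mul_E.symm
        rw [pow_zero, one_mul, (hZ.pow_right d).left_comm, ← mul_assoc E, ← pow_succ']
        simpa using mem_orderedSpan 0 0 0 d (i + 1) j

theorem normalForm_surjective : Function.Surjective normalForm := by
  intro u
  have hu : u ∈ orderedSpan := mem_of_left_stable orderedSpan
    (by simpa using mem_orderedSpan 0 0 0 0 0 0) E_mul_mem H_mul_mem F_mul_mem P_mul_mem
    Q_mul_mem Z_mul_mem u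
  suffices h : orderedSpan ≤ LinearMap.range normalForm from h hu
  refine Submodule.span_le.2 ?_
  rintro _ ⟨a, b, c, d, i, j, rfl⟩
  refine ⟨Finsupp.single (i, j) (monomial (Finsupp.equivFunOnFinite.symm ![a, b, c, d]) 1), ?_⟩
  rw [normalForm_apply, Finsupp.sum_single_index (by simp), lower_monomial]
  simp [lowerMonomial, mul_assoc]

/-- If `w` has weight `κ`, then `f, q, h, z` act on `w` as `X 0, X 1, κ, t`. -/
theorem vermaRep_lower {a t κ : ℂ} {w : PolyFQ} (hw : vermaRep a t H w = C κ * w)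
    (g : MvPolynomial (Fin 4) ℂ) :
    vermaRep a t (lower g) w = aeval ![X 0, X 1, C κ, C t] g * w := by
  have mulPow (φ : Module.End ℂ PolyFQ) (x : PolyFQ) (hφ : ∀ m, φ m = x * m) (n : ℕ)
      (m : PolyFQ) : (φ ^ n) m = x ^ n * m := by
    induction n with
    | zero => simp
    | succ n ih => rw [pow_succ', Module.End.mul_apply, ih, hφ, pow_succ', mul_assoc]
  have hH (n : ℕ) : (vermaRep a t H ^ n) w = C (κ ^ n) * w := by
    induction n with
    | zero => simp
    | succ n ih =>
      rw [pow_succ', Module.End.mul_apply, ih, ← smul_eq_C_mul, map_smul, hw, smul_eq_C_mul,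
        pow_succ, C_mul, mul_assoc]
  induction g using MvPolynomial.induction_on' with
  | monomial m r =>
    simp only [lower_monomial, lowerMonomial, map_smul, map_mul, map_pow, LinearMap.smul_apply,
      Module.End.mul_apply, mulPow _ _ (vermaRep_Z a t), mulPow _ _ (vermaRep_Q a t),
      mulPow _ _ (vermaRep_F a t)]
    rw [← C_pow, ← smul_eq_C_mul, map_smul, hH, aeval_monomial]
    simp [Finsupp.prod_fintype, Fin.prod_univ_four, smul_eq_C_mul]
    ring
  | add p q hp hq => simp [hp, hq, add_mul]

/-- The vectors `(2zf + q²)^k q^l` in the Verma module. -/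
def testVec (t : ℂ) (k l : ℕ) : PolyFQ := (2 * C t * X 0 + X 1 ^ 2) ^ k * X 1 ^ l

theorem testVec_zero_zero (t : ℂ) : testVec t 0 0 = 1 := by simp [testVec]

theorem pderiv_zero_testVec (t : ℂ) (k l : ℕ) :
    pderiv 0 (testVec t k l) = 2 * C t * (k : PolyFQ) * testVec t (k - 1) l := by
  simp [testVec, Derivation.leibniz, Derivation.leibniz_pow, pderiv_X, pderiv_ofNat]
  ring

theorem pderiv_one_testVec (t : ℂ) (k l : ℕ) :
    pderiv 1 (testVec t k l) =
      2 * (k : PolyFQ) * testVec t (k - 1) (l + 1) + (l : PolyFQ) * testVec t k (l - 1) := by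
  simp [testVec, Derivation.leibniz, Derivation.leibniz_pow, pderiv_X, pderiv_ofNat]
  ring

theorem X_one_mul_testVec (t : ℂ) (k l : ℕ) : X 1 * testVec t k l = testVec t k (l + 1) := by
  simp only [testVec]; ring

theorem X_zero_mul_testVec (t : ℂ) (k l : ℕ) :
    2 * C t * (X 0 * testVec t k l) = testVec t (k + 1) l - testVec t k (l + 2) := by
  simp only [testVec]; ring

theorem vermaRep_P_testVec (a t : ℂ) (k l : ℕ) :
    vermaRep a t P (testVec t k l) = C (t * l) * testVec t k (l - 1) := by
  rw [vermaRep_P, pderiv_zero_testVec, pderiv_one_testVec, ← X_one_mul_testVec]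
  simp
  ring

theorem vermaRep_H_testVec (a t : ℂ) (k l : ℕ) :
    vermaRep a t H (testVec t k l) = C (a - 2 * k - l) * testVec t k l := by
  have h0 : (k : PolyFQ) * (2 * C t * (X 0 * testVec t (k - 1) l)) =
      (k : PolyFQ) * (testVec t k l - testVec t (k - 1) (l + 2)) := by
    rcases k with _ | k
    · simp
    · rw [X_zero_mul_testVec]; rfl
  have h1 : (l : PolyFQ) * (X 1 * testVec t k (l - 1)) = (l : PolyFQ) * testVec t k l := by
    rcases l with _ | l
    · simp
    · rw [X_one_mul_testVec]; rfl
  have h2 := X_one_mul_testVec t (k - 1) (l + 1)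
  rw [vermaRep_H, pderiv_zero_testVec, pderiv_one_testVec]
  simp only [C_sub, C_mul, map_natCast, map_ofNat]
  linear_combination (-2) * h0 - h1 - 2 * (k : PolyFQ) * h2

theorem vermaRep_E_testVec (a t : ℂ) (k l : ℕ) :
    vermaRep a t E (testVec t k l) =
      C (t * k * (2 * a + 3 - 2 * k)) * testVec t (k - 1) l
        + C (t / 2 * (l * (l - 1))) * testVec t k (l - 2) := by
  have ht : (C t : PolyFQ) = 2 * C (t / 2) := by
    rw [show (2 : PolyFQ) = C 2 from rfl, ← C_mul]; congr 1; ring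
  have h2 (i : Fin 2) (x : PolyFQ) : pderiv i (2 * x) = 2 * pderiv i x := by
    rw [two_mul, two_mul, map_add]
  have hn (i : Fin 2) (n : ℕ) (x : PolyFQ) : pderiv i ((n : PolyFQ) * x) = n * pderiv i x := by
    rw [← nsmul_eq_mul, map_nsmul, nsmul_eq_mul]
  have C2 : (C 2 : PolyFQ) = 2 := rfl
  have C3 : (C 3 : PolyFQ) = 3 := rfl
  rw [vermaRep_E]
  simp only [pderiv_zero_testVec, pderiv_one_testVec, map_add, mul_assoc, h2, hn, pderiv_C_mul]
  rcases k with _ | _ | k <;> rcases l with _ | _ | l <;>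
  · simp [testVec, ht, C2, C3]
    try ring

theorem vermaRep_P_pow_testVec (a t : ℂ) (k l j : ℕ) :
    vermaRep a t (P ^ j) (testVec t k l) =
      C (t ^ j * l.descFactorial j) * testVec t k (l - j) := by
  induction j with
  | zero => simp
  | succ j ih =>
    rw [pow_succ', map_mul, Module.End.mul_apply, ih, ← smul_eq_C_mul, map_smul,
      vermaRep_P_testVec, smul_eq_C_mul, ← mul_assoc, ← C_mul, Nat.descFactorial_succ,
      Nat.sub_sub]
    congr 2
    push_cast
    ring

theorem vermaRep_E_pow_testVec_eq_zero (a t : ℂ) {i k l : ℕ} (h : 2 * k + l < 2 * i) :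
    vermaRep a t (E ^ i) (testVec t k l) = 0 := by
  induction i generalizing k l with
  | zero => omega
  | succ i ih =>
    rw [pow_succ, map_mul, Module.End.mul_apply, vermaRep_E_testVec, ← smul_eq_C_mul,
      ← smul_eq_C_mul, map_add, map_smul, map_smul]
    have h1 : (t * k * (2 * a + 3 - 2 * k)) • vermaRep a t (E ^ i) (testVec t (k - 1) l) = 0 := by
      rcases k with _ | k
      · simp
      · rw [ih (by omega), smul_zero]
    have h2 : (t / 2 * (l * (l - 1))) • vermaRep a t (E ^ i) (testVec t k (l - 2)) = 0 := by
      rcases l with _ | _ | l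
      · simp
      · simp
      · rw [ih (by omega), smul_zero]
    rw [h1, h2, add_zero]

theorem vermaRep_E_pow_testVec_self (a t : ℂ) (k : ℕ) :
    vermaRep a t (E ^ k) (testVec t k 0) =
      C (∏ r ∈ Finset.range k, t * (r + 1) * (2 * a + 3 - 2 * (r + 1))) := by
  induction k with
  | zero => simp [testVec_zero_zero]
  | succ k ih =>
    rw [pow_succ, map_mul, Module.End.mul_apply, vermaRep_E_testVec, Nat.cast_zero, zero_mul,
      mul_zero, C_0, zero_mul, add_zero, ← smul_eq_C_mul, map_smul, Nat.add_sub_cancel, ih,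
      smul_eq_C_mul, ← C_mul, Finset.prod_range_succ, mul_comm]
    push_cast
    rfl

theorem eval_aeval_lower (g : MvPolynomial (Fin 4) ℂ) (x : Fin 2 → ℂ) (κ t : ℂ) :
    eval x (aeval ![X 0, X 1, C κ, C t] g) = eval ![x 0, x 1, κ, t] g := by
  rw [← coe_aeval_eq_eval, ← coe_aeval_eq_eval, RingHom.coe_coe, RingHom.coe_coe,
    ← AlgHom.comp_apply, comp_aeval]
  congr 2
  funext i
  fin_cases i <;> simp

theorem vermaRep_lower_one (a t : ℂ) (g : MvPolynomial (Fin 4) ℂ) :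
    vermaRep a t (lower g) 1 = aeval ![X 0, X 1, C a, C t] g := by
  simpa using vermaRep_lower (a := a) (t := t) (κ := a) (w := 1) (by simp [vermaRep_H]) g

/-- The Verma modules with nonzero central charge are jointly faithful. -/
theorem eq_zero_of_vermaRep_eq_zero {u : U} (hu : ∀ a t, t ≠ 0 → vermaRep a t u = 0) : u = 0 := by
  obtain ⟨G, rfl⟩ := normalForm_surjective u
  suffices h : ∀ n l k, 2 * k + l = n → G (k, l) = 0 by
    have : G = 0 := Finsupp.ext fun ⟨k, l⟩ => h _ l k rfl
    rw [this, map_zero]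
  intro n
  induction n using Nat.strong_induction_on with
  | _ n ihn =>
  intro l
  induction l using Nat.strong_induction_on with
  | _ l ihl =>
  intro k hn
  have key (a t : ℂ) (ht : t ≠ 0) :
      C (t ^ l * l.factorial * ∏ r ∈ Finset.range k, t * (r + 1) * (2 * a + 3 - 2 * (r + 1))) *
        aeval ![X 0, X 1, C a, C t] (G (k, l)) = (0 : PolyFQ) := by
    have h0 : vermaRep a t (normalForm G) (testVec t k l) = 0 := by
      rw [hu a t ht, LinearMap.zero_apply]
    rw [normalForm_apply, Finsupp.sum, map_sum, LinearMap.sum_apply,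
      Finset.sum_eq_single (k, l)] at h0
    · rw [← h0, map_mul (vermaRep a t), map_mul (vermaRep a t), Module.End.mul_apply,
        Module.End.mul_apply,
        vermaRep_P_pow_testVec, Nat.sub_self, Nat.descFactorial_self]
      simp only [← smul_eq_C_mul, map_smul, vermaRep_E_pow_testVec_self]
      rw [← mul_one (C (∏ r ∈ _, _)), ← smul_eq_C_mul, map_smul, smul_smul, vermaRep_lower_one]
    · rintro ⟨i, j⟩ - hij
      rcases lt_or_ge (2 * i + j) n with h | h
      · simp [ihn _ h j i rfl]
      by_cases hj : j < l ∧ 2 * i + j = n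
      · simp [ihl j hj.1 i hj.2]
      rw [map_mul, map_mul, Module.End.mul_apply, Module.End.mul_apply, vermaRep_P_pow_testVec,
        ← smul_eq_C_mul, map_smul]
      rcases lt_or_ge l j with hl | hl
      · simp [Nat.descFactorial_of_lt hl]
      · have hne : j ≠ l ∨ i ≠ k := by
          by_contra! h'
          exact hij (by rw [h'.1, h'.2])
        rw [vermaRep_E_pow_testVec_eq_zero a t (by omega), smul_zero, map_zero]
    · intro h
      simp [Finsupp.notMem_support_iff.1 h]
  let D : MvPolynomial (Fin 4) ℂ := X 3 ^ l * C (l.factorial : ℂ) *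
    ∏ r ∈ Finset.range k, X 3 * C ((r : ℂ) + 1) * (2 * X 2 + C (3 - 2 * ((r : ℂ) + 1)))
  have hD : D ≠ 0 := by
    intro h
    have h1 : eval ![0, 0, -3 / 2, 1] D = 0 := by rw [h, map_zero]
    simp only [D, map_mul, map_prod, map_pow, map_add, eval_X, eval_C, map_ofNat] at h1
    simp [Finset.prod_eq_zero_iff, Nat.factorial_ne_zero] at h1
    obtain ⟨r, -, h1⟩ := h1
    rcases h1 with h1 | h1
    · exact Nat.cast_add_one_ne_zero r h1
    · exact Nat.cast_add_one_ne_zero r (R := ℂ) (by linear_combination (-1 / 2) * h1)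
  have hz : X 3 * (D * G (k, l)) = 0 := by
    refine MvPolynomial.funext fun x => ?_
    by_cases hx : x 3 = 0
    · simp [hx]
    have h1 := congrArg (eval ![x 0, x 1]) (key (x 2) (x 3) hx)
    rw [map_mul, eval_aeval_lower, eval_C, map_zero] at h1
    have h2 : ![![x 0, x 1] 0, ![x 0, x 1] 1, x 2, x 3] = x := by
      funext i; fin_cases i <;> rfl
    rw [h2] at h1
    have h3 : eval x D =
        x 3 ^ l * l.factorial *
          ∏ r ∈ Finset.range k, x 3 * (r + 1) * (2 * x 2 + 3 - 2 * (r + 1)) := by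
      simp only [D, map_mul, map_prod, map_pow, map_add, eval_X, eval_C, map_ofNat, add_sub_assoc]
    rw [map_mul, map_mul, h3, h1, map_zero, mul_zero]
  rcases mul_eq_zero.1 hz with h | h
  · exact absurd h (X_ne_zero 3)
  · exact (mul_eq_zero.1 h).resolve_left hD

/-- Every element of `U` acts on highest weight vectors through a polynomial in `f, q, h, z`. -/
theorem exists_highestWeight_polynomial (u : U) : ∃ g : MvPolynomial (Fin 4) ℂ,
    ∀ (a t κ : ℂ) (w : PolyFQ), vermaRep a t E w = 0 → vermaRep a t P w = 0 →
      vermaRep a t H w = C κ * w →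
      vermaRep a t u w = aeval ![X 0, X 1, C κ, C t] g * w := by
  obtain ⟨G, rfl⟩ := normalForm_surjective u
  refine ⟨G (0, 0), fun a t κ w hE hP hH => ?_⟩
  rw [normalForm_apply, Finsupp.sum, map_sum, LinearMap.sum_apply, Finset.sum_eq_single (0, 0)]
  · simp [vermaRep_lower hH]
  · rintro ⟨i, j⟩ - hij
    rw [map_mul, map_mul, Module.End.mul_apply, Module.End.mul_apply]
    rcases j with _ | j
    · rcases i with _ | i
      · exact absurd rfl hij
      · simp [pow_succ, hE]
    · simp [pow_succ, hP]
  · intro h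
    simp [Finsupp.notMem_support_iff.1 h]

theorem coeff_X_mul_pderiv (i : Fin 2) (x : PolyFQ) (d : Fin 2 →₀ ℕ) :
    coeff d (X i * pderiv i x) = d i * coeff d x := by
  induction x using MvPolynomial.induction_on' with
  | monomial m r =>
    rw [X_mul_pderiv_monomial, coeff_smul, coeff_monomial, nsmul_eq_mul]
    split_ifs with h
    · rw [h]
    · simp
  | add p q hp hq => rw [map_add, mul_add, coeff_add, hp, hq, coeff_add, mul_add]

/-- The kernel of the grading derivation consists of constants. -/
theorem eq_C_of_degree_derivation_eq_zero {x : PolyFQ}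
    (hx : 2 * (X 0 * pderiv 0 x) + X 1 * pderiv 1 x = 0) : x = C (coeff 0 x) := by
  ext d
  rw [coeff_C]
  split_ifs with hd
  · rw [← hd]
  have h := congrArg (coeff d) hx
  rw [two_mul, coeff_add, coeff_add, coeff_X_mul_pderiv, coeff_X_mul_pderiv, coeff_zero] at h
  have h' : ((2 * d 0 + d 1 : ℕ) : ℂ) * coeff d x = 0 := by push_cast; linear_combination h
  refine (mul_eq_zero.1 h').resolve_left fun h0 => hd ?_
  have h0 : 2 * d 0 + d 1 = 0 := by exact_mod_cast h0
  ext i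
  fin_cases i
  · simp; omega
  · simp; omega

/-- A central element acts on each Verma module by a scalar, given by its highest weight
polynomial. -/
theorem vermaRep_of_mem_center {u : U} (hu : ∀ x, x * u = u * x) {g : MvPolynomial (Fin 4) ℂ}
    {a t : ℂ} (hg : vermaRep a t u 1 = aeval ![X 0, X 1, C a, C t] g) (m : PolyFQ) :
    vermaRep a t u m = C (eval ![0, 0, a, t] g) * m := by
  have comm (x : U) (m : PolyFQ) :
      vermaRep a t u (vermaRep a t x m) = vermaRep a t x (vermaRep a t u m) := by
    rw [← Module.End.mul_apply, ← Module.End.mul_apply, ← map_mul, ← map_mul, hu]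
  have hmul : vermaRep a t u m = vermaRep a t u 1 * m := by
    induction m using MvPolynomial.induction_on with
    | C r => rw [← mul_one (C r), ← smul_eq_C_mul, map_smul, mul_smul_comm, mul_one]
    | add p q hp hq => rw [map_add, hp, hq, mul_add]
    | mul_X p i hp =>
      fin_cases i
      · have h := comm F p
        rw [vermaRep_F, vermaRep_F, hp] at h
        change vermaRep a t u (p * X 0) = _ * (p * X 0)
        rw [mul_comm p, h, mul_left_comm]
      · have h := comm Q p
        rw [vermaRep_Q, vermaRep_Q, hp] at h
        change vermaRep a t u (p * X 1) = _ * (p * X 1)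
        rw [mul_comm p, h, mul_left_comm]
  have hH := comm H 1
  rw [vermaRep_H, vermaRep_H, pderiv_one, pderiv_one, mul_zero, mul_zero, sub_zero, sub_zero,
    ← smul_eq_C_mul, map_smul, smul_eq_C_mul] at hH
  have hc := eq_C_of_degree_derivation_eq_zero (x := vermaRep a t u 1)
    (by linear_combination hH)
  have h0 := congrArg (eval ![0, 0]) hg
  rw [eval_aeval_lower, hc, eval_C] at h0
  rw [hmul, hc, h0]
  rfl

theorem evalEval_aeval_highestWeight (g : MvPolynomial (Fin 4) ℂ) (t ν : ℂ) :
    (aeval ![0, 0, Polynomial.X - Polynomial.C (Polynomial.C (3 / 2)),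
      Polynomial.C Polynomial.X] g : Polynomial (Polynomial ℂ)).evalEval t ν =
    eval ![0, 0, ν - 3 / 2, t] g := by
  induction g using MvPolynomial.induction_on with
  | C r =>
    rw [aeval_C, eval_C]
    exact Polynomial.evalEval_CC t ν r
  | add p q hp hq => simp only [map_add, Polynomial.evalEval_add, hp, hq]
  | mul_X p i hp =>
    rw [map_mul, map_mul, Polynomial.evalEval_mul, hp]
    congr 1
    fin_cases i <;> simp [Polynomial.evalEval_C]

theorem testVec_ne_zero (t : ℂ) (k l : ℕ) : testVec t k l ≠ 0 := by
  intro h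
  have := congrArg (eval ![0, 1]) h
  simp [testVec] at this

/-- A central element acts on the Verma modules through an even polynomial in `a + 3/2` with
coefficients polynomial in the central charge. -/
theorem exists_even_polynomial {u : U} (hu : ∀ x, x * u = u * x) :
    ∃ p : Polynomial (Polynomial ℂ), (∀ n, Odd n → p.coeff n = 0) ∧
      ∀ a t m, vermaRep a t u m = C (p.evalEval t (a + 3 / 2)) * m := by
  obtain ⟨g, hg⟩ := exists_highestWeight_polynomial u
  have hact (a t : ℂ) (m : PolyFQ) : vermaRep a t u m = C (eval ![0, 0, a, t] g) * m := by
    refine vermaRep_of_mem_center hu ?_ m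
    rw [hg a t a 1 (by simp [vermaRep_E]) (by simp [vermaRep_P]) (by simp [vermaRep_H]), mul_one]
  set p : Polynomial (Polynomial ℂ) := aeval ![0, 0,
    Polynomial.X - Polynomial.C (Polynomial.C (3 / 2)), Polynomial.C Polynomial.X] g with hp
  have hpe (t ν : ℂ) : p.evalEval t ν = eval ![0, 0, ν - 3 / 2, t] g :=
    evalEval_aeval_highestWeight g t ν
  have hsymm (k : ℕ) (t : ℂ) : p.evalEval t k = p.evalEval t (-k) := by
    have h := hg (k - 3 / 2) t (-k - 3 / 2) (testVec t k 0)
      (by rw [vermaRep_E_testVec]; simp [show 2 * ((k : ℂ) - 3 / 2) + 3 - 2 * k = 0 by ring])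
      (by rw [vermaRep_P_testVec]; simp)
      (by rw [vermaRep_H_testVec]; congr 2; push_cast; ring)
    rw [hact] at h
    have h' := congrArg (eval ![0, 0]) (mul_right_cancel₀ (testVec_ne_zero t k 0) h)
    rw [eval_C, eval_aeval_lower] at h'
    rw [hpe, hpe, h']
    rfl
  have hcomp : p = p.comp (Polynomial.C (-1) * Polynomial.X) := by
    refine Polynomial.eq_of_infinite_eval_eq _ _ ?_
    refine (Set.infinite_range_of_injective
      (f := fun k : ℕ => (Polynomial.C (k : ℂ) : Polynomial ℂ))
      (Polynomial.C_injective.comp Nat.cast_injective)).mono ?_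
    rintro _ ⟨k, rfl⟩
    refine Polynomial.funext fun t => ?_
    have h := hsymm k t
    simp only [Polynomial.evalEval] at h
    simpa using h
  refine ⟨p, fun n hn => ?_, fun a t m => by rw [hact, hpe, add_sub_cancel_right]⟩
  have h := congrArg (fun q => q.coeff n) hcomp
  simp only [Polynomial.comp_C_mul_X_coeff, hn.neg_one_pow] at h
  have h2 : (2 : Polynomial ℂ) * p.coeff n = 0 := by linear_combination h
  exact (mul_eq_zero.1 h2).resolve_left two_ne_zero

/-- The Casimir element acts on the Verma modules by the scalar `ϑ`. -/
theorem vermaRep_cElt (a t : ℂ) (m : PolyFQ) :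
    vermaRep a t cElt m = C (vartheta a t) * m := by
  have ht : (C t : PolyFQ) = 2 * C (t / 2) := by
    rw [show (2 : PolyFQ) = C 2 from rfl, ← C_mul]; congr 1; ring
  have C2 : (C 2 : PolyFQ) = 2 := rfl
  have C3 : (C 3 : PolyFQ) = 3 := rfl
  have h2 (x : U) (y : PolyFQ) : vermaRep a t (2 * x) y = 2 * vermaRep a t x y := by
    rw [two_mul, two_mul, map_add, LinearMap.add_apply]
  have h4 (x : U) (y : PolyFQ) : vermaRep a t (4 * x) y = 4 * vermaRep a t x y := by
    rw [show (4 : U) = 2 * 2 by norm_num, mul_assoc, h2, h2, ← mul_assoc]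
    norm_num
  rw [cElt, map_sub, LinearMap.sub_apply, h2, map_mul, Module.End.mul_apply]
  simp only [map_add, LinearMap.add_apply, h4]
  simp only [map_sub, map_mul, LinearMap.sub_apply, Module.End.mul_apply, vermaRep_E, vermaRep_F,
    vermaRep_H, vermaRep_P, vermaRep_Q, vermaRep_Z]
  simp [vartheta, Derivation.leibniz, pderiv_X, pderiv_one_pderiv_zero, pderiv_ofNat, ht, C2, C3]
  ring

end

theorem eq_of_vermaRep_eq {u v : U} (h : ∀ a t, t ≠ 0 → vermaRep a t u = vermaRep a t v) :
    u = v :=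
  sub_eq_zero.1 <| eq_zero_of_vermaRep_eq_zero fun a t ht => by rw [map_sub, h a t ht, sub_self]

theorem vermaRep_eq_algebraMap {a t s : ℂ} {u : U}
    (h : ∀ m, vermaRep a t u m = MvPolynomial.C s * m) :
    vermaRep a t u = algebraMap ℂ (Module.End ℂ PolyFQ) s :=
  LinearMap.ext fun m => by
    rw [h, Module.algebraMap_end_apply, MvPolynomial.smul_eq_C_mul]

theorem vermaRep_Z_eq (a t : ℂ) : vermaRep a t Z = algebraMap ℂ _ t :=
  vermaRep_eq_algebraMap (vermaRep_Z a t)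

theorem vermaRep_cElt_eq (a t : ℂ) : vermaRep a t cElt = algebraMap ℂ _ (vartheta a t) :=
  vermaRep_eq_algebraMap (vermaRep_cElt a t)

theorem commute_of_vermaRep_eq {u : U} {s : ℂ → ℂ → ℂ}
    (h : ∀ a t, vermaRep a t u = algebraMap ℂ _ (s a t)) (x : U) : x * u = u * x :=
  eq_of_vermaRep_eq fun a t _ => by
    rw [map_mul, map_mul, h]
    exact (Algebra.commutes _ _).symm

theorem mul_Z_eq (x : U) : x * Z = Z * x :=
  commute_of_vermaRep_eq (s := fun _ t => t) vermaRep_Z_eq x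

theorem adjoin_le_center : Algebra.adjoin ℂ ({Z, cElt} : Set U) ≤ Subalgebra.center ℂ U := by
  refine Algebra.adjoin_le ?_
  rintro _ (rfl | rfl)
  · exact Subalgebra.mem_center_iff.2 mul_Z_eq
  · exact Subalgebra.mem_center_iff.2 (commute_of_vermaRep_eq vermaRep_cElt_eq)

theorem Z_mem_adjoin : Z ∈ Algebra.adjoin ℂ ({Z, cElt} : Set U) :=
  Algebra.subset_adjoin (by simp)

theorem cElt_mem_adjoin : cElt ∈ Algebra.adjoin ℂ ({Z, cElt} : Set U) :=
  Algebra.subset_adjoin (by simp)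

/-- Central elements are polynomial in `z` and `c` up to a power of `z`. -/
theorem exists_Z_pow_mul_mem_adjoin {u : U} (hu : ∀ x, x * u = u * x) :
    ∃ n, Z ^ n * u ∈ Algebra.adjoin ℂ ({Z, cElt} : Set U) := by
  obtain ⟨p, hodd, hp⟩ := exists_even_polynomial hu
  set T : U := cElt + (1 / 4 : ℂ) • Z with hT
  have hTmem : T ∈ Algebra.adjoin ℂ ({Z, cElt} : Set U) :=
    add_mem cElt_mem_adjoin (Subalgebra.smul_mem _ Z_mem_adjoin _)
  have hTact (a t : ℂ) : vermaRep a t T = algebraMap ℂ _ (t * (a + 3 / 2) ^ 2) := by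
    rw [hT, map_add, map_smul, vermaRep_Z_eq, vermaRep_cElt_eq, Algebra.smul_def, ← map_mul,
      ← map_add, vartheta]
    congr 1
    ring
  have hpoly (a t : ℂ) (q : Polynomial ℂ) :
      vermaRep a t (Polynomial.aeval Z q) = algebraMap ℂ _ (q.eval t) := by
    rw [← Polynomial.aeval_algHom_apply, vermaRep_Z_eq, Polynomial.aeval_algebraMap_apply,
      Polynomial.coe_aeval_eq_eval]
  have hsum : Z ^ p.natDegree * u = ∑ i ∈ Finset.range (p.natDegree + 1),
      Polynomial.aeval Z (p.coeff i) * T ^ (i / 2) * Z ^ (p.natDegree - i / 2) := by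
    refine eq_of_vermaRep_eq fun a t _ => ?_
    simp only [map_mul, map_sum, map_pow, hpoly, hTact, vermaRep_Z_eq,
      vermaRep_eq_algebraMap (hp a t)]
    simp only [← map_mul, ← map_sum, ← map_pow]
    congr 1
    rw [Polynomial.evalEval, Polynomial.eval_eq_sum_range (p := p), Polynomial.eval_finsetSum,
      Finset.mul_sum]
    refine Finset.sum_congr rfl fun i hi => ?_
    rcases Nat.even_or_odd i with ⟨j, rfl⟩ | hi'
    · have hj : j ≤ p.natDegree := by have := Finset.mem_range.1 hi; omega
      obtain ⟨r, hr⟩ := Nat.exists_eq_add_of_le hj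
      rw [show (j + j) / 2 = j by omega, hr, Nat.add_sub_cancel_left]
      simp only [Polynomial.eval_mul, Polynomial.eval_pow, Polynomial.eval_C, mul_pow,
        ← pow_mul (a + 3 / 2)]
      ring
    · simp [hodd i hi']
  refine ⟨p.natDegree, hsum ▸ sum_mem fun i _ => mul_mem (mul_mem ?_ (pow_mem hTmem _))
    (pow_mem Z_mem_adjoin _)⟩
  exact Algebra.adjoin_mono (by simp) (Polynomial.aeval_mem_adjoin_singleton ℂ Z)

/-- A weighted shift operator on functions on the lattice `ℤ × ℤ`. -/
def shiftOp (r : ℤ → ℤ → ℂ) (m n : ℤ) : Module.End ℂ (ℤ → ℤ → ℂ) where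
  toFun φ i j := r i j * φ (i + m) (j + n)
  map_add' φ ψ := by funext i j; simp [mul_add]
  map_smul' c φ := by funext i j; simp [mul_left_comm]

/-- A representation of `U` with `z` acting by zero and `c` by an arbitrary scalar: think of
`f = q ∂_p`, `e = p ∂_q + s q⁻²`, `h = p ∂_p - q ∂_q` on Laurent series in `p, q`. -/
theorem exists_chargelessHom (s : ℂ) : ∃ φ : U →ₐ[ℂ] Module.End ℂ (ℤ → ℤ → ℂ),
    φ Z = 0 ∧ φ cElt = algebraMap ℂ _ (2 * s) := by
  have h2 (x : Module.End ℂ (ℤ → ℤ → ℂ)) (y) : (2 * x) y = 2 * x y := by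
    rw [two_mul, two_mul, LinearMap.add_apply]
  obtain ⟨φ, hE, hH, hF, hP, hQ, hZ⟩ :
      ∃ φ : U →ₐ[ℂ] Module.End ℂ (ℤ → ℤ → ℂ), _ := by
    refine exists_algHom
      (shiftOp (fun _ j => j + 1) (-1) 1 + shiftOp (fun _ _ => s) 0 2)
      (shiftOp (fun i j => i - j) 0 0) (shiftOp (fun i _ => i + 1) 1 (-1))
      (shiftOp (fun _ _ => 1) (-1) 0) (shiftOp (fun _ _ => 1) 0 (-1)) 0
      ?_ ?_ ?_ ?_ ?_ ?_ ?_ ?_ ?_ ?_ ?_ ?_ ?_ ?_ ?_ <;>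
    · refine LinearMap.ext fun y => funext fun i => funext fun j => ?_
      simp [h2, shiftOp]
      try ring_nf
  refine ⟨φ, hZ, ?_⟩
  have h2' : φ 2 = 2 := map_ofNat φ 2
  rw [cElt, map_sub, map_mul, map_mul, hZ, mul_zero, zero_sub, h2']
  simp only [map_mul, map_sub, hE, hH, hF, hP, hQ]
  refine LinearMap.ext fun y => ?_
  rw [LinearMap.neg_apply, h2]
  funext i j
  simp [shiftOp]
  ring_nf

theorem exists_eq_aeval_cElt_add_Z_mul {x : U}
    (hx : x ∈ Algebra.adjoin ℂ ({Z, cElt} : Set U)) :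
    ∃ g : Polynomial ℂ, ∃ y ∈ Algebra.adjoin ℂ ({Z, cElt} : Set U),
      x = Polynomial.aeval cElt g + Z * y := by
  have haeval (g : Polynomial ℂ) :
      Polynomial.aeval cElt g ∈ Algebra.adjoin ℂ ({Z, cElt} : Set U) :=
    Algebra.adjoin_mono (by simp) (Polynomial.aeval_mem_adjoin_singleton ℂ cElt)
  induction hx using Algebra.adjoin_induction with
  | mem x hx =>
    rcases hx with rfl | rfl
    · exact ⟨0, 1, one_mem _, by simp⟩
    · exact ⟨Polynomial.X, 0, zero_mem _, by simp⟩
  | algebraMap r => exact ⟨Polynomial.C r, 0, zero_mem _, by simp⟩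
  | add x x' _ _ hx hx' =>
    obtain ⟨g, y, hy, rfl⟩ := hx
    obtain ⟨g', y', hy', rfl⟩ := hx'
    exact ⟨g + g', y + y', add_mem hy hy', by rw [map_add, mul_add]; abel⟩
  | mul x x' _ hxm hx hx' =>
    obtain ⟨g, y, hy, rfl⟩ := hx
    obtain ⟨g', y', hy', rfl⟩ := hx'
    refine ⟨g * g', Polynomial.aeval cElt g * y' + y * (Polynomial.aeval cElt g' + Z * y'),
      add_mem (mul_mem (haeval g) hy') (mul_mem hy hxm), ?_⟩
    rw [map_mul, add_mul, mul_add, ← mul_assoc _ Z y', mul_Z_eq, mul_add Z, mul_assoc Z,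
      mul_assoc Z, add_assoc]

theorem eq_zero_of_Z_mul_eq_zero {u : U} (hu : Z * u = 0) : u = 0 := by
  refine eq_zero_of_vermaRep_eq_zero fun a t ht => ?_
  have h := congrArg (vermaRep a t) hu
  rw [map_mul, vermaRep_Z_eq, ← Algebra.smul_def, map_zero] at h
  exact (smul_eq_zero.1 h).resolve_left ht

theorem mem_adjoin_of_Z_mul_mem {u : U}
    (hu : Z * u ∈ Algebra.adjoin ℂ ({Z, cElt} : Set U)) :
    u ∈ Algebra.adjoin ℂ ({Z, cElt} : Set U) := by
  obtain ⟨g, y, hy, h⟩ := exists_eq_aeval_cElt_add_Z_mul hu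
  have hg : g = 0 := by
    refine Polynomial.funext fun r => ?_
    obtain ⟨φ, hZ, hc⟩ := exists_chargelessHom (r / 2)
    have h' := congrArg φ h
    rw [map_mul, map_add, map_mul, hZ, zero_mul, zero_mul, add_zero,
      ← Polynomial.aeval_algHom_apply, hc, Polynomial.aeval_algebraMap_apply,
      Polynomial.coe_aeval_eq_eval, mul_div_cancel₀ r two_ne_zero] at h'
    rw [Polynomial.eval_zero]
    exact (map_eq_zero_iff _ (FaithfulSMul.algebraMap_injective ℂ _)).1 h'.symm
  rw [hg, map_zero, zero_add] at h
  have h0 : u - y = 0 := eq_zero_of_Z_mul_eq_zero (by rw [mul_sub, h, sub_self])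
  rwa [sub_eq_zero.1 h0]

end

end Schrodinger

namespace Schrodinger

/-- Corollary 23 of the paper: the center of the universal
enveloping algebra of the Schrödinger algebra is generated by `z` and the
Casimir element `c`: `Z(s) = ℂ[z, c]`. -/
theorem center_eq_adjoin_z_c :
    Subalgebra.center ℂ U = Algebra.adjoin ℂ ({Z, cElt} : Set U) := by
  refine le_antisymm (fun u hu => ?_) adjoin_le_center
  obtain ⟨n, hn⟩ := exists_Z_pow_mul_mem_adjoin (Subalgebra.mem_center_iff.1 hu)
  induction n with
  | zero => simpa using hn
  | succ n ih => exact ih (mem_adjoin_of_Z_mul_mem (by rwa [← mul_assoc, ← pow_succ']))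

end Schrodinger
end
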